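/- Let Ψ be an Orlicz function, (Ω,P) a probability space, X a closed linear subspace of the Morse–Transue space M^Ψ, Y a Banach space, and T : X → Y a bounded linear operator. Then T fixes no copy of c₀ if and only if: for every ε > 0 there exists C_ε > 0 such that ‖Tf‖ ≤ [C_ε ∫_Ω Ψ(ε |f| / ‖f‖_Ψ) dP + ε] · ‖f‖_Ψ for every nonzero f ∈ X. -/

import Mathlib

open MeasureTheory Filter Set Topology ENNReal NNReal

noncomputable section

/-- An Orlicz function: non-decreasing, convex (indeed strictly convex), vanishing and
continuous at `0`, with `Ψ x / x → ∞` as `x → ∞`. (We regard it as a function `ℝ → ℝ`,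
only its values on `[0,∞)` being relevant.) -/
structure IsOrliczFunction (Ψ : ℝ → ℝ) : Prop where
  map_zero : Ψ 0 = 0
  nonneg : ∀ x, 0 ≤ Ψ x
  mono : MonotoneOn Ψ (Set.Ici (0 : ℝ))
  strictConvexOn : StrictConvexOn ℝ (Set.Ici (0 : ℝ)) Ψ
  continuousWithinAt_zero : ContinuousWithinAt Ψ (Set.Ici (0 : ℝ)) 0
  tendsto_div_atTop : Tendsto (fun x => Ψ x / x) atTop atTop

/-- The Orlicz modular `∫ Ψ(|f|/C) dμ` (as an extended nonneg real). -/
def orliczModular {Ω : Type*} [MeasurableSpace Ω] (Ψ : ℝ → ℝ) (μ : Measure Ω)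
    (f : Ω → ℂ) (C : ℝ) : ℝ≥0∞ :=
  ∫⁻ ω, ENNReal.ofReal (Ψ (‖f ω‖ / C)) ∂μ

/-- The Luxemburg norm. -/
def luxNorm {Ω : Type*} [MeasurableSpace Ω] (Ψ : ℝ → ℝ) (μ : Measure Ω) (f : Ω → ℂ) : ℝ :=
  sInf {C : ℝ | 0 < C ∧ orliczModular Ψ μ f C ≤ 1}

/-- Membership in the Orlicz space `L^Ψ`. -/
def MemOrlicz {Ω : Type*} [MeasurableSpace Ω] (Ψ : ℝ → ℝ) (μ : Measure Ω) (f : Ω → ℂ) : Prop :=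
  AEStronglyMeasurable f μ ∧ ∃ C > 0, orliczModular Ψ μ f C < ⊤

/-- Membership in the Morse–Transue space `M^Ψ` (the closure of `L^∞` in `L^Ψ`). -/
def MemMorseTransue {Ω : Type*} [MeasurableSpace Ω] (Ψ : ℝ → ℝ) (μ : Measure Ω)
    (f : Ω → ℂ) : Prop :=
  AEStronglyMeasurable f μ ∧ ∀ C > 0, orliczModular Ψ μ f C < ⊤

/-- A subspace `X` is closed (in the Luxemburg norm) in the Morse–Transue space. -/
def IsLuxClosedIn {Ω : Type*} [MeasurableSpace Ω] (Ψ : ℝ → ℝ) (μ : Measure Ω)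
    (X : Submodule ℂ (Ω → ℂ)) : Prop :=
  ∀ f : Ω → ℂ, MemMorseTransue Ψ μ f →
    (∀ ε > 0, ∃ g ∈ X, luxNorm Ψ μ (f - g) < ε) → f ∈ X

/-- A set in a normed space is relatively weakly compact. -/
def RelWeaklyCompact {Y : Type*} [NormedAddCommGroup Y] [NormedSpace ℂ Y] (S : Set Y) : Prop :=
  ∃ K : Set (WeakSpace ℂ Y), IsCompact K ∧ (toWeakSpace ℂ Y) '' S ⊆ K

/-- The unit ball of a subspace `X` of `L^Ψ` for the Luxemburg norm. -/
def luxUnitBall {Ω : Type*} [MeasurableSpace Ω] (Ψ : ℝ → ℝ) (μ : Measure Ω)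
    (X : Submodule ℂ (Ω → ℂ)) : Set X :=
  {f : X | luxNorm Ψ μ (f : Ω → ℂ) ≤ 1}

/-- An operator on a subspace of `L^Ψ` is weakly compact if the image of the unit ball is
relatively weakly compact. -/
def IsWeaklyCompactOp {Ω : Type*} [MeasurableSpace Ω] (Ψ : ℝ → ℝ) (μ : Measure Ω)
    {X : Submodule ℂ (Ω → ℂ)} {Y : Type*} [NormedAddCommGroup Y] [NormedSpace ℂ Y]
    (T : X →ₗ[ℂ] Y) : Prop :=
  RelWeaklyCompact (⇑T '' luxUnitBall Ψ μ X)

/-- An operator on a subspace of `L^Ψ` is compact if the image of the unit ball is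
relatively norm compact. -/
def IsCompactOp {Ω : Type*} [MeasurableSpace Ω] (Ψ : ℝ → ℝ) (μ : Measure Ω)
    {X : Submodule ℂ (Ω → ℂ)} {Y : Type*} [NormedAddCommGroup Y] [NormedSpace ℂ Y]
    (T : X →ₗ[ℂ] Y) : Prop :=
  IsCompact (closure (⇑T '' luxUnitBall Ψ μ X))

/-- `T` fixes a copy of `c₀`: there is a sequence in `X`, equivalent to the canonical basis
of `c₀`, on whose (closed) span `T` is an isomorphism onto its image. -/
def FixesCopyOfC0 {Ω : Type*} [MeasurableSpace Ω] (Ψ : ℝ → ℝ) (μ : Measure Ω)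
    {X : Submodule ℂ (Ω → ℂ)} {Y : Type*} [NormedAddCommGroup Y] [NormedSpace ℂ Y]
    (T : X →ₗ[ℂ] Y) : Prop :=
  ∃ (u : ℕ → X) (a b c : ℝ), 0 < a ∧ 0 < b ∧ 0 < c ∧
    ∀ (co : ℕ → ℂ) (s : Finset ℕ),
      a * (⨆ k ∈ s, ‖co k‖) ≤ luxNorm Ψ μ ((∑ k ∈ s, co k • u k : X) : Ω → ℂ) ∧
      luxNorm Ψ μ ((∑ k ∈ s, co k • u k : X) : Ω → ℂ) ≤ b * (⨆ k ∈ s, ‖co k‖) ∧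
      c * (⨆ k ∈ s, ‖co k‖) ≤ ‖T (∑ k ∈ s, co k • u k)‖

/-- The complementary (conjugate) Orlicz function `Φ(x) = sup_{y ≥ 0} (xy - Ψ(y))`. -/
def complementaryOrlicz (Ψ : ℝ → ℝ) (x : ℝ) : ℝ :=
  sSup ((fun y => x * y - Ψ y) '' Set.Ici (0 : ℝ))

/-- The `Δ₂` condition. -/
def Delta2 (Φ : ℝ → ℝ) : Prop :=
  ∃ K > 0, ∃ x₀ > 0, ∀ x ≥ x₀, Φ (2 * x) ≤ K * Φ x

/-- The `Δ⁰` condition: for some `β > 1`, `Ψ(βx)/Ψ(x) → ∞` as `x → ∞`. -/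
def Delta0 (Ψ : ℝ → ℝ) : Prop :=
  ∃ β > 1, Tendsto (fun x => Ψ (β * x) / Ψ x) atTop atTop

end

namespace IsOrliczFunction

variable {Ψ : ℝ → ℝ}

lemma mono' (hΨ : IsOrliczFunction Ψ) {x y : ℝ} (hx : 0 ≤ x) (hxy : x ≤ y) : Ψ x ≤ Ψ y :=
  hΨ.mono hx (hx.trans hxy) hxy

lemma pos (hΨ : IsOrliczFunction Ψ) {x : ℝ} (hx : 0 < x) : 0 < Ψ x := by
  have h := hΨ.strictConvexOn.2 (show (0 : ℝ) ∈ Ici 0 by simp) (show x ∈ Ici 0 from hx.le) hx.ne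
    (show (0 : ℝ) < 1 / 2 by norm_num) (show (0 : ℝ) < 1 / 2 by norm_num) (by norm_num)
  have h0 := hΨ.nonneg ((1 / 2 : ℝ) • 0 + (1 / 2 : ℝ) • x)
  simp only [hΨ.map_zero, smul_eq_mul] at h h0
  linarith

/-- Midpoint convexity in the form used to split sums. -/
lemma add_le (hΨ : IsOrliczFunction Ψ) {x y : ℝ} (hx : 0 ≤ x) (hy : 0 ≤ y) :
    Ψ (x + y) ≤ (Ψ (2 * x) + Ψ (2 * y)) / 2 := by
  have h := hΨ.strictConvexOn.convexOn.2 (show 2 * x ∈ Ici 0 from mul_nonneg zero_le_two hx)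
    (show 2 * y ∈ Ici 0 from mul_nonneg zero_le_two hy)
    (show (0 : ℝ) ≤ 1 / 2 by norm_num) (show (0 : ℝ) ≤ 1 / 2 by norm_num) (by norm_num)
  simp only [smul_eq_mul] at h
  have e : 1 / 2 * (2 * x) + 1 / 2 * (2 * y) = x + y := by ring
  rw [e] at h
  linarith

lemma map_mul_le (hΨ : IsOrliczFunction Ψ) {t x : ℝ} (ht : 0 ≤ t) (ht1 : t ≤ 1) (hx : 0 ≤ x) :
    Ψ (t * x) ≤ t * Ψ x := by
  have h := hΨ.strictConvexOn.convexOn.2 (x := x) (y := 0) hx (show (0 : ℝ) ≤ 0 from le_rfl)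
    ht (sub_nonneg.2 ht1) (by ring)
  simpa [hΨ.map_zero] using h

lemma continuous_comp_max (hΨ : IsOrliczFunction Ψ) : Continuous fun x => Ψ (max x 0) := by
  have hc : ContinuousOn Ψ (Ici 0) := by
    intro x hx
    rcases eq_or_lt_of_le (show (0 : ℝ) ≤ x from hx) with rfl | hx
    · exact hΨ.continuousWithinAt_zero
    · have h := hΨ.strictConvexOn.convexOn.continuousOn_interior
      rw [interior_Ici] at h
      exact (h.continuousAt (Ioi_mem_nhds hx)).continuousWithinAt
  exact hc.comp_continuous (by fun_prop) fun x => le_max_right x 0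

lemma exists_le_add (hΨ : IsOrliczFunction Ψ) : ∃ R, 0 ≤ R ∧ ∀ t, 0 ≤ t → t ≤ Ψ t + R := by
  obtain ⟨R, hR⟩ := eventually_atTop.1 (hΨ.tendsto_div_atTop.eventually_ge_atTop 1)
  refine ⟨max R 1, by positivity, fun t ht => ?_⟩
  rcases le_total t (max R 1) with h | h
  · linarith [hΨ.nonneg t]
  · have h1 := hR t ((le_max_left _ _).trans h)
    have htp : 0 < t := lt_of_lt_of_le (by positivity) h
    rw [le_div_iff₀ htp] at h1
    have : 0 ≤ max R 1 := by positivity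
    linarith

lemma aemeasurable_comp {Ω : Type*} [MeasurableSpace Ω] {μ : Measure Ω}
    (hΨ : IsOrliczFunction Ψ) {S : Ω → ℝ} (hS : AEMeasurable S μ) (h0 : ∀ ω, 0 ≤ S ω) :
    AEMeasurable (fun ω => ENNReal.ofReal (Ψ (S ω))) μ := by
  have h := (hΨ.continuous_comp_max.measurable.comp_aemeasurable hS).ennreal_ofReal
  refine h.congr (ae_of_all _ fun ω => ?_)
  simp [max_eq_left (h0 ω)]

lemma tendsto_comp (hΨ : IsOrliczFunction Ψ) {t : ℕ → ℝ} {x : ℝ} (h0 : ∀ n, 0 ≤ t n)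
    (ht : Tendsto t atTop (𝓝 x)) :
    Tendsto (fun n => ENNReal.ofReal (Ψ (t n))) atTop (𝓝 (ENNReal.ofReal (Ψ x))) := by
  have hx : 0 ≤ x := ge_of_tendsto' ht h0
  have h := (hΨ.continuous_comp_max.tendsto x).comp ht
  refine (ENNReal.continuous_ofReal.tendsto _).comp ?_
  simpa [Function.comp_def, max_eq_left, h0, hx] using h

lemma tendsto_zero_of_comp (hΨ : IsOrliczFunction Ψ) {t : ℕ → ℝ} (h0 : ∀ n, 0 ≤ t n)
    (ht : Tendsto (fun n => ENNReal.ofReal (Ψ (t n))) atTop (𝓝 0)) :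
    Tendsto t atTop (𝓝 0) := by
  rw [Metric.tendsto_atTop]
  intro δ hδ
  have h := ht.eventually_lt_const (ENNReal.ofReal_pos.2 (hΨ.pos hδ))
  obtain ⟨N, hN⟩ := eventually_atTop.1 h
  refine ⟨N, fun n hn => ?_⟩
  rw [Real.dist_eq, sub_zero, abs_of_nonneg (h0 n)]
  by_contra! hc
  exact absurd (hN n hn) (not_lt.2 (ENNReal.ofReal_le_ofReal (hΨ.mono' hδ.le hc)))

end IsOrliczFunction

/-- The choice of signs which is `1` on `A` and `-1` off `A`. -/
def signOn (A : Finset ℕ) (k : ℕ) : ℝ := if k ∈ A then 1 else -1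

lemma abs_signOn (A : Finset ℕ) (k : ℕ) : |signOn A k| = 1 := by
  unfold signOn; split_ifs <;> simp

lemma signOn_sq (A : Finset ℕ) (k : ℕ) : signOn A k ^ 2 = 1 := by
  unfold signOn; split_ifs <;> simp

lemma signOn_self_insert (A : Finset ℕ) (j : ℕ) : signOn (insert j A) j = 1 := by
  simp [signOn]

lemma signOn_of_notMem {A : Finset ℕ} {j : ℕ} (h : j ∉ A) : signOn A j = -1 := by
  simp [signOn, h]

lemma signOn_insert_of_ne (A : Finset ℕ) {j k : ℕ} (h : k ≠ j) :
    signOn (insert j A) k = signOn A k := by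
  simp [signOn, h]

/-- The expectation of a random signed sum against a Riesz product. -/
lemma sum_powerset_riesz (x θ : ℕ → ℝ) (s : Finset ℕ) :
    (∑ A ∈ s.powerset, ∏ k ∈ s, (1 + Complex.I * (signOn A k * θ k : ℝ)) = 2 ^ s.card) ∧
    (∑ A ∈ s.powerset, ((∑ k ∈ s, signOn A k * x k : ℝ) : ℂ) *
      ∏ k ∈ s, (1 + Complex.I * (signOn A k * θ k : ℝ)) =
        2 ^ s.card * (Complex.I * (∑ k ∈ s, x k * θ k : ℝ))) := by
  induction s using Finset.induction_on with
  | empty => simp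
  | insert j s hj ih =>
    have hne : ∀ k ∈ s, k ≠ j := fun k hk h => hj (h ▸ hk)
    have e1 : ∀ A ∈ s.powerset, signOn A j = -1 := fun A hA =>
      signOn_of_notMem fun h => hj (Finset.mem_powerset.1 hA h)
    have e2 : ∀ A, ∏ k ∈ s, (1 + Complex.I * (signOn (insert j A) k * θ k : ℝ)) =
        ∏ k ∈ s, (1 + Complex.I * (signOn A k * θ k : ℝ)) := fun A =>
      Finset.prod_congr rfl fun k hk => by rw [signOn_insert_of_ne A (hne k hk)]
    have e3 : ∀ A, ∑ k ∈ s, signOn (insert j A) k * x k = ∑ k ∈ s, signOn A k * x k := fun A =>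
      Finset.sum_congr rfl fun k hk => by rw [signOn_insert_of_ne A (hne k hk)]
    constructor
    · rw [Finset.sum_powerset_insert hj, ← Finset.sum_add_distrib, Finset.card_insert_of_notMem hj,
        pow_succ, ← ih.1, Finset.sum_mul]
      refine Finset.sum_congr rfl fun A hA => ?_
      rw [Finset.prod_insert hj, Finset.prod_insert hj, e1 A hA, signOn_self_insert, e2]
      push_cast
      ring
    · rw [Finset.sum_powerset_insert hj, ← Finset.sum_add_distrib, Finset.card_insert_of_notMem hj,
        Finset.sum_insert hj]
      have : (2 : ℂ) ^ (s.card + 1) * (Complex.I * ((x j * θ j + ∑ k ∈ s, x k * θ k : ℝ) : ℂ)) =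
          2 * (2 ^ s.card * (Complex.I * (∑ k ∈ s, x k * θ k : ℝ))) +
            2 * Complex.I * x j * θ j * 2 ^ s.card := by
        push_cast; ring
      rw [this, ← ih.2, ← ih.1, Finset.mul_sum, Finset.mul_sum, ← Finset.sum_add_distrib]
      refine Finset.sum_congr rfl fun A hA => ?_
      rw [Finset.prod_insert hj, Finset.prod_insert hj, Finset.sum_insert hj, Finset.sum_insert hj,
        e1 A hA, signOn_self_insert, e2, e3]
      push_cast
      ring

lemma sum_abs_le_sum_powerset (x : ℕ → ℝ) (n : ℕ) :
    2 ^ n * ∑ k ∈ Finset.range n, |x k| ≤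
      2 * √n * ∑ A ∈ (Finset.range n).powerset, |∑ k ∈ Finset.range n, signOn A k * x k| := by
  rcases Nat.eq_zero_or_pos n with rfl | hn
  · simp
  have hn' : (0 : ℝ) < n := by exact_mod_cast hn
  have hs : 0 < √(n : ℝ) := Real.sqrt_pos.2 hn'
  set θ : ℕ → ℝ := fun k => (SignType.sign (x k) : ℝ) / √n with hθ
  have hθ2 : ∀ k, θ k ^ 2 ≤ 1 / n := by
    intro k
    simp only [hθ, div_pow, Real.sq_sqrt hn'.le]
    gcongr
    rcases lt_trichotomy (x k) 0 with h | h | h <;> simp [h]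
  have hP : ∀ A, ‖∏ k ∈ Finset.range n, (1 + Complex.I * (signOn A k * θ k : ℝ))‖ ≤ 2 := by
    intro A
    have h1 : ‖∏ k ∈ Finset.range n, (1 + Complex.I * (signOn A k * θ k : ℝ))‖ ^ 2 ≤ 2 ^ 2 := by
      rw [norm_prod, ← Finset.prod_pow]
      have h2 : ∀ k ∈ Finset.range n,
          ‖(1 + Complex.I * (signOn A k * θ k : ℝ))‖ ^ 2 ≤ Real.exp (1 / n) := by
        intro k _
        have h3 : ‖(1 + Complex.I * (signOn A k * θ k : ℝ))‖ ^ 2 = 1 + θ k ^ 2 := by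
          rw [← Complex.normSq_eq_norm_sq, Complex.normSq_apply]
          simp
          nlinarith [signOn_sq A k]
        rw [h3]
        linarith [hθ2 k, Real.add_one_le_exp (1 / (n : ℝ))]
      refine (Finset.prod_le_prod (fun k _ => by positivity) h2).trans ?_
      rw [Finset.prod_const, Finset.card_range, ← Real.exp_nat_mul, mul_one_div_cancel hn'.ne']
      linarith [Real.exp_one_lt_d9]
    exact le_of_sq_le_sq h1 (by norm_num)
  have h := (sum_powerset_riesz x θ (Finset.range n)).2
  have hx : ∑ k ∈ Finset.range n, x k * θ k = (∑ k ∈ Finset.range n, |x k|) / √n := by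
    rw [Finset.sum_div]
    refine Finset.sum_congr rfl fun k _ => ?_
    simp only [hθ, mul_div_assoc']
    rw [mul_comm, sign_mul_self]
  have hnorm := congrArg norm h
  rw [hx, Finset.card_range, norm_mul, norm_mul, Complex.norm_I, Complex.norm_real, norm_pow,
    Complex.norm_ofNat, Real.norm_of_nonneg (by positivity), one_mul] at hnorm
  have hle : 2 ^ n * ((∑ k ∈ Finset.range n, |x k|) / √n) ≤
      ∑ A ∈ (Finset.range n).powerset, |∑ k ∈ Finset.range n, signOn A k * x k| * 2 := by
    rw [← hnorm]
    refine (norm_sum_le _ _).trans (Finset.sum_le_sum fun A _ => ?_)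
    rw [norm_mul, Complex.norm_real, Real.norm_eq_abs]
    gcongr
    exact hP A
  rw [← Finset.sum_mul, ← mul_div_assoc, div_le_iff₀ hs] at hle
  linarith

/-- An `ℓ¹`-lower bound for the average of random signed sums. -/
lemma sum_norm_le_sum_powerset (v : ℕ → ℂ) (n : ℕ) :
    2 ^ n * ∑ k ∈ Finset.range n, ‖v k‖ ≤
      4 * √n * ∑ A ∈ (Finset.range n).powerset,
        ‖∑ k ∈ Finset.range n, (signOn A k : ℂ) * v k‖ := by
  have hre := sum_abs_le_sum_powerset (fun k => (v k).re) n
  have him := sum_abs_le_sum_powerset (fun k => (v k).im) n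
  have hr : ∑ A ∈ (Finset.range n).powerset, |∑ k ∈ Finset.range n, signOn A k * (v k).re| ≤
      ∑ A ∈ (Finset.range n).powerset, ‖∑ k ∈ Finset.range n, (signOn A k : ℂ) * v k‖ := by
    refine Finset.sum_le_sum fun A _ => ?_
    refine le_trans (le_of_eq ?_) (Complex.abs_re_le_norm _)
    simp
  have hi : ∑ A ∈ (Finset.range n).powerset, |∑ k ∈ Finset.range n, signOn A k * (v k).im| ≤
      ∑ A ∈ (Finset.range n).powerset, ‖∑ k ∈ Finset.range n, (signOn A k : ℂ) * v k‖ := by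
    refine Finset.sum_le_sum fun A _ => ?_
    refine le_trans (le_of_eq ?_) (Complex.abs_im_le_norm _)
    simp
  have hv : ∑ k ∈ Finset.range n, ‖v k‖ ≤
      ∑ k ∈ Finset.range n, |(v k).re| + ∑ k ∈ Finset.range n, |(v k).im| := by
    rw [← Finset.sum_add_distrib]
    exact Finset.sum_le_sum fun k _ => Complex.norm_le_abs_re_add_abs_im _
  have hs := Real.sqrt_nonneg (n : ℝ)
  calc _ ≤ 2 ^ n * (∑ k ∈ Finset.range n, |(v k).re| + ∑ k ∈ Finset.range n, |(v k).im|) := by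
        gcongr
    _ ≤ _ := by nlinarith [mul_le_mul_of_nonneg_left hr hs, mul_le_mul_of_nonneg_left hi hs]

lemma IsOrliczFunction.le_sum_powerset {Ψ : ℝ → ℝ} (hΨ : IsOrliczFunction Ψ) {B : ℝ} (hB : 0 < B)
    (v : ℕ → ℂ) (s : Finset ℕ) {j : ℕ} (hj : j ∈ s) :
    2 ^ s.card * Ψ (‖v j‖ / B) ≤
      ∑ A ∈ s.powerset, Ψ (‖∑ k ∈ s, (signOn A k : ℂ) * v k‖ / B) := by
  obtain ⟨t, hjt, rfl⟩ : ∃ t, j ∉ t ∧ insert j t = s :=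
    ⟨s.erase j, Finset.notMem_erase j s, Finset.insert_erase hj⟩
  have hne : ∀ k ∈ t, k ≠ j := fun k hk h => hjt (h ▸ hk)
  have hcard : (2 : ℝ) ^ (t.card + 1) * Ψ (‖v j‖ / B) =
      ∑ A ∈ t.powerset, 2 * Ψ (‖v j‖ / B) := by
    rw [Finset.sum_const, Finset.card_powerset, nsmul_eq_mul]; push_cast; ring
  rw [Finset.sum_powerset_insert hjt, ← Finset.sum_add_distrib, Finset.card_insert_of_notMem hjt,
    hcard]
  refine Finset.sum_le_sum fun A hA => ?_
  have e : ∑ k ∈ t, (signOn (insert j A) k : ℂ) * v k = ∑ k ∈ t, (signOn A k : ℂ) * v k :=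
    Finset.sum_congr rfl fun k hk => by rw [signOn_insert_of_ne A (hne k hk)]
  rw [Finset.sum_insert hjt, Finset.sum_insert hjt, e, signOn_self_insert,
    signOn_of_notMem fun h => hjt (Finset.mem_powerset.1 hA h)]
  set R := ∑ k ∈ t, (signOn A k : ℂ) * v k
  have h1 : 2 * ‖v j‖ ≤ ‖((-1 : ℝ) : ℂ) * v j + R‖ + ‖((1 : ℝ) : ℂ) * v j + R‖ := by
    have := norm_sub_le (((1 : ℝ) : ℂ) * v j + R) (((-1 : ℝ) : ℂ) * v j + R)
    have e2 : ((1 : ℝ) : ℂ) * v j + R - (((-1 : ℝ) : ℂ) * v j + R) = 2 * v j := by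
      push_cast; ring
    rw [e2, norm_mul, Complex.norm_ofNat] at this
    linarith
  set p := ‖((-1 : ℝ) : ℂ) * v j + R‖
  set q := ‖((1 : ℝ) : ℂ) * v j + R‖
  have hp : 0 ≤ p := norm_nonneg _
  have hq : 0 ≤ q := norm_nonneg _
  have h2 : ‖v j‖ / B ≤ p / B / 2 + q / B / 2 := by
    rw [← add_div, ← add_div, div_div, div_le_div_iff₀ hB (by positivity)]
    nlinarith
  have h3 := (hΨ.mono' (by positivity) h2).trans
    (hΨ.add_le (x := p / B / 2) (y := q / B / 2) (by positivity) (by positivity))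
  rw [mul_div_cancel₀ _ (two_ne_zero' ℝ), mul_div_cancel₀ _ (two_ne_zero' ℝ)] at h3
  linarith

/-- Rosenthal's disjointness lemma for nonnegative matrices with bounded rows. -/
lemma exists_injective_sum_le (δ : ℝ) (m : ℕ) :
    ∀ a : ℕ → ℕ → ℝ, (∀ i j, 0 ≤ a i j) →
    (∀ j (s : Finset ℕ), j ∉ s → ∑ k ∈ s, a j k ≤ (m + 1) * δ) →
    ∃ φ : ℕ → ℕ, Function.Injective φ ∧
      ∀ j (s : Finset ℕ), j ∉ s → ∑ k ∈ s, a (φ j) (φ k) ≤ δ := by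
  induction m with
  | zero => exact fun a _ h => ⟨id, Function.injective_id, by simpa using h⟩
  | succ m ih =>
    intro a ha h
    have hinj : ∀ p, Function.Injective (Nat.pair p) := fun p q q' e => (Nat.pair_eq_pair.1 e).2
    by_cases hp : ∃ p, ∀ q (s : Finset ℕ), q ∉ s →
        ∑ k ∈ s, a (Nat.pair p q) (Nat.pair p k) ≤ δ
    · obtain ⟨p, hp⟩ := hp
      exact ⟨Nat.pair p, hinj p, hp⟩
    push Not at hp
    choose q t hqt hlt using hp
    have hψ : Function.Injective fun p => Nat.pair p (q p) := fun p p' e =>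
      (Nat.pair_eq_pair.1 e).1
    obtain ⟨φ, hφ, hsum⟩ := ih (fun i j => a (Nat.pair i (q i)) (Nat.pair j (q j)))
      (fun i j => ha _ _) (by
        intro p s hps
        have hdisj : Disjoint (s.map ⟨_, hψ⟩) ((t p).map ⟨_, hinj p⟩) := by
          rw [Finset.disjoint_left]
          simp only [Finset.mem_map, Function.Embedding.coeFn_mk, not_exists, not_and]
          rintro _ ⟨p', hp', rfl⟩ x _ e
          exact hps ((Nat.pair_eq_pair.1 e).1 ▸ hp')
        have := h (Nat.pair p (q p)) (s.map ⟨_, hψ⟩ ∪ (t p).map ⟨_, hinj p⟩) (by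
          simp only [Finset.mem_union, Finset.mem_map, Function.Embedding.coeFn_mk, not_or,
            not_exists, not_and]
          refine ⟨fun x hx e => hps ((Nat.pair_eq_pair.1 e).1 ▸ hx), fun x hx e => ?_⟩
          exact hqt p ((Nat.pair_eq_pair.1 e).2 ▸ hx))
        rw [Finset.sum_union hdisj, Finset.sum_map, Finset.sum_map] at this
        simp only [Function.Embedding.coeFn_mk] at this
        push_cast at this
        linarith [hlt p])
    exact ⟨fun j => Nat.pair (φ j) (q (φ j)), hψ.comp hφ, hsum⟩

section Modular

variable {Ω : Type*} [MeasurableSpace Ω] {μ : Measure Ω} {Ψ : ℝ → ℝ}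

lemma luxNorm_nonneg (f : Ω → ℂ) : 0 ≤ luxNorm Ψ μ f :=
  Real.sInf_nonneg fun _ hC => hC.1.le

lemma luxNorm_le {f : Ω → ℂ} {C : ℝ} (hC : 0 < C) (h : orliczModular Ψ μ f C ≤ 1) :
    luxNorm Ψ μ f ≤ C :=
  csInf_le ⟨0, fun _ hC => hC.1.le⟩ ⟨hC, h⟩

lemma orliczModular_antitone (hΨ : IsOrliczFunction Ψ) (f : Ω → ℂ) {C C' : ℝ} (hC : 0 < C)
    (h : C ≤ C') : orliczModular Ψ μ f C' ≤ orliczModular Ψ μ f C :=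
  lintegral_mono fun ω => ENNReal.ofReal_le_ofReal <| hΨ.mono'
    (div_nonneg (norm_nonneg _) (hC.le.trans h)) (by gcongr)

lemma exists_orliczModular_le_one (hΨ : IsOrliczFunction Ψ) {f : Ω → ℂ}
    (hf : MemMorseTransue Ψ μ f) : ∃ C, 0 < C ∧ orliczModular Ψ μ f C ≤ 1 := by
  have hfin := hf.2 1 one_pos
  set m := orliczModular Ψ μ f 1 with hm
  set C := max 1 m.toReal with hC
  have hC1 : 1 ≤ C := le_max_left _ _
  have hC0 : 0 < C := one_pos.trans_le hC1
  refine ⟨C, hC0, ?_⟩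
  calc orliczModular Ψ μ f C ≤ ∫⁻ ω, ENNReal.ofReal C⁻¹ * ENNReal.ofReal (Ψ (‖f ω‖ / 1)) ∂μ := by
        refine lintegral_mono fun ω => ?_
        rw [← ENNReal.ofReal_mul (by positivity)]
        refine ENNReal.ofReal_le_ofReal ?_
        have := hΨ.map_mul_le (t := C⁻¹) (x := ‖f ω‖) (by positivity) (inv_le_one_of_one_le₀ hC1)
          (norm_nonneg _)
        rwa [div_one, div_eq_inv_mul]
    _ = ENNReal.ofReal C⁻¹ * m := lintegral_const_mul' _ _ ENNReal.ofReal_ne_top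
    _ ≤ ENNReal.ofReal C⁻¹ * ENNReal.ofReal C := by
        gcongr
        rw [← ENNReal.ofReal_toReal hfin.ne]
        exact ENNReal.ofReal_le_ofReal (le_max_right _ _)
    _ = 1 := by
        rw [← ENNReal.ofReal_mul (by positivity), inv_mul_cancel₀ hC0.ne', ENNReal.ofReal_one]

lemma orliczModular_le_one_of_luxNorm_lt (hΨ : IsOrliczFunction Ψ) {f : Ω → ℂ}
    (hf : MemMorseTransue Ψ μ f) {B : ℝ} (h : luxNorm Ψ μ f < B) :
    orliczModular Ψ μ f B ≤ 1 := by
  obtain ⟨C, hC, hCB⟩ := exists_lt_of_csInf_lt (exists_orliczModular_le_one hΨ hf) h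
  exact (orliczModular_antitone hΨ f hC.1 hCB.le).trans hC.2

lemma integrable_and_integral_norm_le [IsProbabilityMeasure μ] (hΨ : IsOrliczFunction Ψ) {B : ℝ}
    (hB : 0 < B) : ∃ K, 0 ≤ K ∧ ∀ f : Ω → ℂ, AEStronglyMeasurable f μ →
      orliczModular Ψ μ f B ≤ 1 → Integrable f μ ∧ ∫ ω, ‖f ω‖ ∂μ ≤ K := by
  obtain ⟨R, hR0, hR⟩ := hΨ.exists_le_add
  refine ⟨B * (1 + R), by positivity, fun f hf h => ?_⟩
  have hle : ∫⁻ ω, ENNReal.ofReal ‖f ω‖ ∂μ ≤ ENNReal.ofReal (B * (1 + R)) := by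
    calc ∫⁻ ω, ENNReal.ofReal ‖f ω‖ ∂μ
        ≤ ∫⁻ ω, ENNReal.ofReal B * (ENNReal.ofReal (Ψ (‖f ω‖ / B)) + ENNReal.ofReal R) ∂μ := by
          refine lintegral_mono fun ω => ?_
          rw [← ENNReal.ofReal_add (hΨ.nonneg _) hR0, ← ENNReal.ofReal_mul hB.le]
          refine ENNReal.ofReal_le_ofReal ?_
          have := hR (‖f ω‖ / B) (by positivity)
          rwa [div_le_iff₀' hB] at this
      _ = ENNReal.ofReal B * (orliczModular Ψ μ f B + ENNReal.ofReal R) := by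
          rw [lintegral_const_mul' _ _ ENNReal.ofReal_ne_top,
            lintegral_add_right _ measurable_const]
          simp [orliczModular]
      _ ≤ ENNReal.ofReal B * (1 + ENNReal.ofReal R) := by gcongr
      _ = _ := by
          rw [← ENNReal.ofReal_one, ← ENNReal.ofReal_add zero_le_one hR0,
            ← ENNReal.ofReal_mul hB.le]
  refine ⟨⟨hf, ?_⟩, ?_⟩
  · rw [hasFiniteIntegral_iff_norm]
    exact hle.trans_lt ENNReal.ofReal_lt_top
  · rw [integral_eq_lintegral_of_nonneg_ae (ae_of_all _ fun ω => norm_nonneg _) hf.norm]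
    exact ENNReal.toReal_le_of_le_ofReal (by positivity) hle

lemma ae_tendsto_zero_of_tsum_lintegral_ne_top {F : ℕ → Ω → ℝ≥0∞} (hF : ∀ n, AEMeasurable (F n) μ)
    (h : ∑' n, ∫⁻ ω, F n ω ∂μ ≠ ⊤) : ∀ᵐ ω ∂μ, Tendsto (fun n => F n ω) atTop (𝓝 0) := by
  rw [← lintegral_tsum hF] at h
  filter_upwards [ae_lt_top' (AEMeasurable.tsum hF) h] with ω hω
  exact ENNReal.tendsto_atTop_zero_of_tsum_ne_top hω.ne

end Modular

lemma le_biSup_norm (co : ℕ → ℂ) (s : Finset ℕ) {k : ℕ} (hk : k ∈ s) :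
    ‖co k‖ ≤ ⨆ k ∈ s, ‖co k‖ := by
  have hb : BddAbove (Set.range fun k => ⨆ _ : k ∈ s, ‖co k‖) := by
    refine ⟨∑ k ∈ s, ‖co k‖, ?_⟩
    rintro _ ⟨k, rfl⟩
    refine Real.iSup_le (fun hk => ?_) (Finset.sum_nonneg fun _ _ => norm_nonneg _)
    exact Finset.single_le_sum (f := fun k => ‖co k‖) (fun _ _ => norm_nonneg _) hk
  refine le_trans ?_ (le_ciSup hb k)
  simp [hk]

lemma biSup_norm_le (co : ℕ → ℂ) (s : Finset ℕ) {M : ℝ} (hM : 0 ≤ M) (h : ∀ k ∈ s, ‖co k‖ ≤ M) :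
    ⨆ k ∈ s, ‖co k‖ ≤ M :=
  Real.iSup_le (fun k => Real.iSup_le (fun hk => h k hk) hM) hM

lemma biSup_norm_nonneg (co : ℕ → ℂ) (s : Finset ℕ) : 0 ≤ ⨆ k ∈ s, ‖co k‖ :=
  Real.iSup_nonneg fun _ => Real.iSup_nonneg fun _ => norm_nonneg _

section SignedSums

variable {Ω : Type*} [MeasurableSpace Ω] {μ : Measure Ω} {Ψ : ℝ → ℝ} {u : ℕ → Ω → ℂ} {B : ℝ}

/-- If all signed sums are bounded in `L^Ψ`, the maximal function belongs to `L^Ψ`. -/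
lemma lintegral_iSup_le_one (hΨ : IsOrliczFunction Ψ) (hB : 0 < B)
    (hu : ∀ k, AEStronglyMeasurable (u k) μ)
    (hmod : ∀ A n, orliczModular Ψ μ (fun ω => ∑ k ∈ Finset.range n, (signOn A k : ℂ) * u k ω) B
      ≤ 1) :
    ∫⁻ ω, ⨆ k, ENNReal.ofReal (Ψ (‖u k ω‖ / B)) ∂μ ≤ 1 := by
  set F : ℕ → Ω → ℝ≥0∞ := fun k ω => ENNReal.ofReal (Ψ (‖u k ω‖ / B)) with hF
  have hFm : ∀ k, AEMeasurable (F k) μ := fun k =>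
    hΨ.aemeasurable_comp ((hu k).norm.aemeasurable.div_const B) fun ω => by positivity
  have hSm : ∀ A n, AEMeasurable (fun ω => ENNReal.ofReal
      (Ψ (‖∑ k ∈ Finset.range n, (signOn A k : ℂ) * u k ω‖ / B))) μ := fun A n => by
    refine hΨ.aemeasurable_comp (AEMeasurable.div_const ?_ B) fun ω => by positivity
    refine (AEStronglyMeasurable.norm ?_).aemeasurable
    exact Finset.aestronglyMeasurable_fun_sum _ fun k _ => (hu k).const_mul _
  have e : ∀ ω, ⨆ k, F k ω = ⨆ n, ⨆ k ∈ Finset.range n, F k ω := by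
    intro ω
    refine le_antisymm (iSup_le fun k => ?_) (iSup_le fun n => iSup₂_le fun k _ => le_iSup (F · ω) k)
    exact le_iSup_of_le (k + 1) (le_iSup₂_of_le k (by simp) le_rfl)
  refine (lintegral_congr e).trans_le ?_
  rw [lintegral_iSup']
  · refine iSup_le fun n => ?_
    calc ∫⁻ ω, ⨆ k ∈ Finset.range n, F k ω ∂μ
        ≤ ∫⁻ ω, ENNReal.ofReal (2 ^ n)⁻¹ * ∑ A ∈ (Finset.range n).powerset, ENNReal.ofReal
            (Ψ (‖∑ k ∈ Finset.range n, (signOn A k : ℂ) * u k ω‖ / B)) ∂μ := by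
          refine lintegral_mono fun ω => iSup₂_le fun j hj => ?_
          rw [← ENNReal.ofReal_sum_of_nonneg fun _ _ => hΨ.nonneg _,
            ← ENNReal.ofReal_mul (by positivity)]
          refine ENNReal.ofReal_le_ofReal ?_
          have := hΨ.le_sum_powerset hB (fun k => u k ω) (Finset.range n) hj
          rw [Finset.card_range] at this
          rwa [le_inv_mul_iff₀ (by positivity)]
      _ = ENNReal.ofReal (2 ^ n)⁻¹ * ∑ A ∈ (Finset.range n).powerset,
            orliczModular Ψ μ (fun ω => ∑ k ∈ Finset.range n, (signOn A k : ℂ) * u k ω) B := by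
          rw [lintegral_const_mul' _ _ ENNReal.ofReal_ne_top,
            lintegral_finsetSum' _ fun A _ => hSm A n]
          rfl
      _ ≤ ENNReal.ofReal (2 ^ n)⁻¹ * ∑ A ∈ (Finset.range n).powerset, 1 := by
          gcongr with A _
          exact hmod A n
      _ = 1 := by
          rw [Finset.sum_const, Finset.card_powerset, Finset.card_range, nsmul_one,
            ← ENNReal.ofReal_natCast, ← ENNReal.ofReal_mul (by positivity)]
          simp
  · intro n
    exact AEMeasurable.biSup _ (Finset.range n).countable_toSet fun k _ => hFm k
  · refine ae_of_all _ fun ω m n hmn => ?_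
    exact biSup_mono fun k hk => Finset.range_mono hmn hk

/-- If all signed sums are bounded in `L^Ψ`, the terms come arbitrarily close to `0` in `L¹`. -/
lemma exists_integral_norm_lt [IsProbabilityMeasure μ] (hΨ : IsOrliczFunction Ψ) (hB : 0 < B)
    (hu : ∀ k, AEStronglyMeasurable (u k) μ) (hmod1 : ∀ k, orliczModular Ψ μ (u k) B ≤ 1)
    (hmod : ∀ A n, orliczModular Ψ μ (fun ω => ∑ k ∈ Finset.range n, (signOn A k : ℂ) * u k ω) B
      ≤ 1) {δ : ℝ} (hδ : 0 < δ) :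
    ∃ k, ∫ ω, ‖u k ω‖ ∂μ < δ := by
  obtain ⟨K, hK0, hK⟩ := integrable_and_integral_norm_le (μ := μ) hΨ hB
  by_contra! hge
  obtain ⟨n, hn⟩ := exists_nat_gt ((4 * K / δ) ^ 2)
  have hn0 : (0 : ℝ) < n := (sq_nonneg _).trans_lt hn
  have hs : 0 < √(n : ℝ) := Real.sqrt_pos.2 hn0
  have hSm : ∀ A, AEStronglyMeasurable
      (fun ω => ∑ k ∈ Finset.range n, (signOn A k : ℂ) * u k ω) μ := fun A =>
    Finset.aestronglyMeasurable_fun_sum _ fun k _ => (hu k).const_mul _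
  have huint : ∀ k, Integrable (fun ω => ‖u k ω‖) μ := fun k => (hK _ (hu k) (hmod1 k)).1.norm
  have hSint : ∀ A, Integrable
      (fun ω => ‖∑ k ∈ Finset.range n, (signOn A k : ℂ) * u k ω‖) μ := fun A =>
    (hK _ (hSm A) (hmod A n)).1.norm
  have h1 : ∫ ω, 2 ^ n * ∑ k ∈ Finset.range n, ‖u k ω‖ ∂μ ≤
      ∫ ω, 4 * √n * ∑ A ∈ (Finset.range n).powerset,
        ‖∑ k ∈ Finset.range n, (signOn A k : ℂ) * u k ω‖ ∂μ :=
    integral_mono ((integrable_finsetSum _ fun k _ => huint k).const_mul _)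
      ((integrable_finsetSum _ fun A _ => hSint A).const_mul _)
      fun ω => sum_norm_le_sum_powerset (fun k => u k ω) n
  rw [integral_const_mul, integral_const_mul, integral_finsetSum _ fun k _ => huint k,
    integral_finsetSum _ fun A _ => hSint A] at h1
  have h2 : (n : ℝ) * δ ≤ ∑ k ∈ Finset.range n, ∫ ω, ‖u k ω‖ ∂μ := by
    simpa using Finset.card_nsmul_le_sum (Finset.range n) _ δ fun k _ => hge k
  have h3 : ∑ A ∈ (Finset.range n).powerset,
      ∫ ω, ‖∑ k ∈ Finset.range n, (signOn A k : ℂ) * u k ω‖ ∂μ ≤ 2 ^ n * K := by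
    simpa using Finset.sum_le_card_nsmul (Finset.range n).powerset _ K
      fun A _ => (hK _ (hSm A) (hmod A n)).2
  have h4 : (2 : ℝ) ^ n * (n * δ) ≤ 2 ^ n * (4 * √n * K) := by
    calc _ ≤ 2 ^ n * ∑ k ∈ Finset.range n, ∫ ω, ‖u k ω‖ ∂μ := by gcongr
      _ ≤ _ := h1
      _ ≤ 4 * √n * (2 ^ n * K) := by gcongr
      _ = _ := by ring
  have h5 : n * δ ≤ 4 * √n * K := le_of_mul_le_mul_left h4 (by positivity)
  have h6 : √(n : ℝ) * δ ≤ 4 * K := by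
    refine le_of_mul_le_mul_left (?_ : √(n : ℝ) * (√(n : ℝ) * δ) ≤ √(n : ℝ) * (4 * K)) hs
    rw [← mul_assoc, Real.mul_self_sqrt hn0.le]
    linarith
  have h7 : 4 * K / δ < √(n : ℝ) := Real.lt_sqrt_of_sq_lt hn
  rw [div_lt_iff₀ hδ] at h7
  linarith

end SignedSums

lemma coe_sum_smul_apply {Ω : Type*} {X : Submodule ℂ (Ω → ℂ)} (u : ℕ → X) (co : ℕ → ℂ)
    (s : Finset ℕ) :
    ((∑ k ∈ s, co k • u k : X) : Ω → ℂ) = fun ω => ∑ k ∈ s, co k * (u k : Ω → ℂ) ω := by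
  ext ω
  simp [Finset.sum_apply]

section Operators

variable {Ω : Type*} [MeasurableSpace Ω] {μ : Measure Ω} {Ψ : ℝ → ℝ}

lemma not_fixesCopyOfC0_of_estimate [IsProbabilityMeasure μ] (hΨ : IsOrliczFunction Ψ)
    (X : Submodule ℂ (Ω → ℂ)) (hXM : ∀ f ∈ X, MemMorseTransue Ψ μ f)
    {Y : Type*} [NormedAddCommGroup Y] [NormedSpace ℂ Y] (T : X →ₗ[ℂ] Y)
    (hest : ∀ ε > 0, ∃ C > 0, ∀ f : X, luxNorm Ψ μ (f : Ω → ℂ) ≠ 0 →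
      ‖T f‖ ≤ (C * (orliczModular Ψ μ (f : Ω → ℂ)
        (luxNorm Ψ μ (f : Ω → ℂ) / ε)).toReal + ε) * luxNorm Ψ μ (f : Ω → ℂ)) :
    ¬ FixesCopyOfC0 Ψ μ T := by
  rintro ⟨u, a, b, c, ha, hb, hc, H⟩
  have hB : 0 < b + 1 := by positivity
  have hu : ∀ k, AEStronglyMeasurable (u k : Ω → ℂ) μ := fun k => (hXM _ (u k).2).1
  have hsingle : ∀ k, a ≤ luxNorm Ψ μ (u k : Ω → ℂ) ∧ luxNorm Ψ μ (u k : Ω → ℂ) ≤ b ∧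
      c ≤ ‖T (u k)‖ := by
    intro k
    have h := H (fun _ => 1) {k}
    have h1 : (⨆ j ∈ ({k} : Finset ℕ), ‖(1 : ℂ)‖) = 1 := le_antisymm
      (biSup_norm_le (fun _ => 1) _ zero_le_one (by simp))
      (by simpa only [norm_one] using le_biSup_norm (fun _ => 1) {k} (Finset.mem_singleton_self k))
    rw [h1] at h
    simpa using h
  have hmod : ∀ A n, orliczModular Ψ μ
      (fun ω => ∑ k ∈ Finset.range n, (signOn A k : ℂ) * (u k : Ω → ℂ) ω) (b + 1) ≤ 1 := by
    intro A n
    rw [← coe_sum_smul_apply u (fun k => (signOn A k : ℂ))]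
    refine orliczModular_le_one_of_luxNorm_lt hΨ (hXM _ (Subtype.property _)) ?_
    have h1 : (⨆ k ∈ Finset.range n, ‖(signOn A k : ℂ)‖) ≤ 1 :=
      biSup_norm_le (fun k => (signOn A k : ℂ)) _ zero_le_one fun k _ => by
        rw [Complex.norm_real, Real.norm_eq_abs, abs_signOn]
    have h2 := (H (fun k => (signOn A k : ℂ)) (Finset.range n)).2.1
    nlinarith
  have hmod1 : ∀ k, orliczModular Ψ μ (u k : Ω → ℂ) (b + 1) ≤ 1 := fun k =>
    orliczModular_le_one_of_luxNorm_lt hΨ (hXM _ (u k).2) (by linarith [(hsingle k).2.1])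
  choose k hk using fun m : ℕ => exists_integral_norm_lt hΨ hB hu hmod1 hmod
    (δ := (1 / 2) ^ m) (by positivity)
  obtain ⟨K, _, hK⟩ := integrable_and_integral_norm_le (μ := μ) hΨ hB
  have hlim : ∀ᵐ ω ∂μ, Tendsto (fun m => ENNReal.ofReal ‖(u (k m) : Ω → ℂ) ω‖) atTop (𝓝 0) := by
    refine ae_tendsto_zero_of_tsum_lintegral_ne_top
      (fun m => (hu (k m)).norm.aemeasurable.ennreal_ofReal) ?_
    refine ne_top_of_le_ne_top ?_ (ENNReal.tsum_le_tsum (g := fun m => ENNReal.ofReal ((1 / 2) ^ m))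
      fun m => ?_)
    · rw [← ENNReal.ofReal_tsum_of_nonneg (fun m => by positivity) summable_geometric_two]
      exact ENNReal.ofReal_ne_top
    · rw [← ofReal_integral_eq_lintegral_ofReal (hK _ (hu _) (hmod1 _)).1.norm
        (ae_of_all _ fun ω => norm_nonneg _)]
      exact ENNReal.ofReal_le_ofReal (hk m).le
  set ε := min (a / (b + 1)) (c / (2 * b)) with hε
  have hε0 : 0 < ε := lt_min (by positivity) (by positivity)
  have hεB : b + 1 ≤ a / ε := by
    rw [le_div_iff₀ hε0, ← le_div_iff₀' hB]
    exact min_le_left _ _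
  have hεc : ε * b ≤ c / 2 := by
    have : ε ≤ c / (2 * b) := min_le_right _ _
    rw [le_div_iff₀ (by positivity)] at this
    linarith
  have hconv : Tendsto (fun m => orliczModular Ψ μ (u (k m) : Ω → ℂ) (a / ε)) atTop (𝓝 0) := by
    have h := tendsto_lintegral_of_dominated_convergence' (μ := μ)
      (F := fun m ω => ENNReal.ofReal (Ψ (‖(u (k m) : Ω → ℂ) ω‖ / (a / ε)))) (f := fun _ => 0)
      (fun ω => ⨆ k, ENNReal.ofReal (Ψ (‖(u k : Ω → ℂ) ω‖ / (b + 1))))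
      (fun m => hΨ.aemeasurable_comp ((hu (k m)).norm.aemeasurable.div_const _)
        fun ω => by positivity)
      (fun m => ae_of_all _ fun ω => ?_)
      (ne_top_of_le_ne_top ENNReal.one_ne_top (lintegral_iSup_le_one hΨ hB hu hmod)) ?_
    · simpa [orliczModular] using h
    · refine le_iSup_of_le (k m) (ENNReal.ofReal_le_ofReal (hΨ.mono' (by positivity) ?_))
      gcongr
    · filter_upwards [hlim] with ω hω
      have h1 : Tendsto (fun m => ‖(u (k m) : Ω → ℂ) ω‖) atTop (𝓝 0) := by
        have := (ENNReal.tendsto_toReal ENNReal.zero_ne_top).comp hω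
        simpa [Function.comp_def] using this
      have h2 := hΨ.tendsto_comp (fun m => by positivity) (h1.div_const (a / ε))
      simpa [hΨ.map_zero] using h2
  obtain ⟨C, hC, hCest⟩ := hest ε hε0
  have hle : ∀ m, c ≤ (C * (orliczModular Ψ μ (u (k m) : Ω → ℂ) (a / ε)).toReal + ε) * b := by
    intro m
    obtain ⟨h1, h2, h3⟩ := hsingle (k m)
    refine h3.trans ((hCest _ (ha.trans_le h1).ne').trans ?_)
    have h4 : (orliczModular Ψ μ (u (k m) : Ω → ℂ) (luxNorm Ψ μ (u (k m) : Ω → ℂ) / ε)).toReal ≤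
        (orliczModular Ψ μ (u (k m) : Ω → ℂ) (a / ε)).toReal :=
      ENNReal.toReal_mono ((hXM _ (u (k m)).2).2 _ (by positivity)).ne
        (orliczModular_antitone hΨ _ (by positivity) (by gcongr))
    gcongr
    exact luxNorm_nonneg _
  have hlimit := ge_of_tendsto' (((((ENNReal.tendsto_toReal ENNReal.zero_ne_top).comp
    hconv).const_mul C).add_const ε).mul_const b) hle
  simp only [ENNReal.toReal_zero, mul_zero, zero_add] at hlimit
  linarith

/-- Adding a late term of a modularly summable sequence hardly changes the modular. -/
lemma exists_lintegral_add_lt_one (hΨ : IsOrliczFunction Ψ) {c : ℝ} (hc : 0 < c)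
    {g : ℕ → Ω → ℂ} (hg : ∀ n, AEStronglyMeasurable (g n) μ)
    (hsum : ∑' n, ∫⁻ ω, ENNReal.ofReal (Ψ (2 * c * ‖g n ω‖)) ∂μ ≠ ⊤)
    {S : Ω → ℝ} (hS : AEMeasurable S μ) (hS0 : ∀ ω, 0 ≤ S ω)
    (hSfin : ∫⁻ ω, ENNReal.ofReal (Ψ (2 * c * S ω)) ∂μ ≠ ⊤)
    (hS1 : ∫⁻ ω, ENNReal.ofReal (Ψ (c * S ω)) ∂μ < 1) :
    ∃ n, ∫⁻ ω, ENNReal.ofReal (Ψ (c * (S ω + ‖g n ω‖))) ∂μ < 1 := by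
  have hgm : ∀ n, AEMeasurable (fun ω => ENNReal.ofReal (Ψ (2 * c * ‖g n ω‖))) μ := fun n =>
    hΨ.aemeasurable_comp ((hg n).norm.aemeasurable.const_mul _) fun ω => by positivity
  have hSm : AEMeasurable (fun ω => ENNReal.ofReal (Ψ (2 * c * S ω))) μ :=
    hΨ.aemeasurable_comp (hS.const_mul _) fun ω => mul_nonneg (by positivity) (hS0 ω)
  have h := tendsto_lintegral_of_dominated_convergence' (μ := μ)
    (F := fun n ω => ENNReal.ofReal (Ψ (c * (S ω + ‖g n ω‖))))
    (f := fun ω => ENNReal.ofReal (Ψ (c * S ω)))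
    (fun ω => ENNReal.ofReal (Ψ (2 * c * S ω)) + ∑' n, ENNReal.ofReal (Ψ (2 * c * ‖g n ω‖)))
    (fun n => hΨ.aemeasurable_comp ((hS.add (hg n).norm.aemeasurable).const_mul _)
      fun ω => mul_nonneg hc.le (add_nonneg (hS0 ω) (norm_nonneg _)))
    (fun n => ae_of_all _ fun ω => ?_) ?_ ?_
  · exact (h.eventually_lt_const hS1).exists
  · refine le_trans ?_ (add_le_add_right (ENNReal.le_tsum n) _)
    rw [← ENNReal.ofReal_add (hΨ.nonneg _) (hΨ.nonneg _)]
    refine ENNReal.ofReal_le_ofReal ?_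
    have h1 := hΨ.add_le (mul_nonneg hc.le (hS0 ω)) (mul_nonneg hc.le (norm_nonneg (g n ω)))
    rw [← mul_add, ← mul_assoc, ← mul_assoc] at h1
    linarith [hΨ.nonneg (2 * c * S ω), hΨ.nonneg (2 * c * ‖g n ω‖)]
  · rw [lintegral_add_left' hSm, lintegral_tsum hgm]
    exact ENNReal.add_ne_top.2 ⟨hSfin, hsum⟩
  · filter_upwards [ae_tendsto_zero_of_tsum_lintegral_ne_top hgm hsum] with ω hω
    have h1 := hΨ.tendsto_zero_of_comp (fun n => by positivity) hω
    have h2 : Tendsto (fun n => ‖g n ω‖) atTop (𝓝 0) := by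
      have := h1.const_mul (2 * c)⁻¹
      simpa [← mul_assoc, inv_mul_cancel₀ (show 2 * c ≠ 0 by positivity), hc.ne'] using this
    refine hΨ.tendsto_comp (fun n => mul_nonneg hc.le (add_nonneg (hS0 ω) (norm_nonneg _))) ?_
    simpa using (h2.const_add (S ω)).const_mul c

lemma lintegral_add_ne_top (hΨ : IsOrliczFunction Ψ) {S R : Ω → ℝ} (hS : AEMeasurable S μ)
    (hS0 : ∀ ω, 0 ≤ S ω) (hR0 : ∀ ω, 0 ≤ R ω)
    (hSfin : ∀ c > 0, ∫⁻ ω, ENNReal.ofReal (Ψ (c * S ω)) ∂μ ≠ ⊤)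
    (hRfin : ∀ c > 0, ∫⁻ ω, ENNReal.ofReal (Ψ (c * R ω)) ∂μ ≠ ⊤) (c : ℝ) (hc : 0 < c) :
    ∫⁻ ω, ENNReal.ofReal (Ψ (c * (S ω + R ω))) ∂μ ≠ ⊤ := by
  refine ne_top_of_le_ne_top (ENNReal.add_ne_top.2
    ⟨hSfin (2 * c) (by positivity), hRfin (2 * c) (by positivity)⟩) ?_
  rw [← lintegral_add_left' (hΨ.aemeasurable_comp (hS.const_mul _)
    fun ω => mul_nonneg (by positivity) (hS0 ω))]
  refine lintegral_mono fun ω => ?_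
  rw [← ENNReal.ofReal_add (hΨ.nonneg _) (hΨ.nonneg _)]
  refine ENNReal.ofReal_le_ofReal ?_
  have h1 := hΨ.add_le (mul_nonneg hc.le (hS0 ω)) (mul_nonneg hc.le (hR0 ω))
  rw [← mul_add, ← mul_assoc, ← mul_assoc] at h1
  linarith [hΨ.nonneg (2 * c * S ω), hΨ.nonneg (2 * c * R ω)]

/-- A modularly summable sequence in `M^Ψ` has a subfamily whose absolute partial sums are bounded
in `L^Ψ`. -/
lemma exists_seq_lintegral_sum_lt_one (hΨ : IsOrliczFunction Ψ) {c : ℝ} (hc : 0 < c)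
    {g : ℕ → Ω → ℂ} (hg : ∀ n, MemMorseTransue Ψ μ (g n))
    (hsum : ∑' n, ∫⁻ ω, ENNReal.ofReal (Ψ (2 * c * ‖g n ω‖)) ∂μ ≠ ⊤) :
    ∃ n : ℕ → ℕ, ∀ m,
      ∫⁻ ω, ENNReal.ofReal (Ψ (c * ∑ k ∈ Finset.range m, ‖g (n k) ω‖)) ∂μ < 1 := by
  let Good : (Ω → ℝ) → Prop := fun S => AEMeasurable S μ ∧ (∀ ω, 0 ≤ S ω) ∧
    (∀ d > 0, ∫⁻ ω, ENNReal.ofReal (Ψ (d * S ω)) ∂μ ≠ ⊤) ∧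
    ∫⁻ ω, ENNReal.ofReal (Ψ (c * S ω)) ∂μ < 1
  have hgfin : ∀ n, ∀ d > 0, ∫⁻ ω, ENNReal.ofReal (Ψ (d * ‖g n ω‖)) ∂μ ≠ ⊤ := by
    intro n d hd
    have := (hg n).2 d⁻¹ (by positivity)
    simp only [orliczModular, div_inv_eq_mul, mul_comm _ d] at this
    exact this.ne
  have hstep : ∀ S : {S // Good S}, ∃ n, Good fun ω => S.1 ω + ‖g n ω‖ := by
    rintro ⟨S, hS, hS0, hSfin, hS1⟩
    obtain ⟨n, hn⟩ := exists_lintegral_add_lt_one hΨ hc (fun n => (hg n).1) hsum hS hS0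
      (hSfin _ (by positivity)) hS1
    exact ⟨n, hS.add (hg n).1.norm.aemeasurable, fun ω => add_nonneg (hS0 ω) (norm_nonneg _),
      lintegral_add_ne_top hΨ hS hS0 (fun _ => norm_nonneg _) hSfin (hgfin n), hn⟩
  choose N hN using hstep
  have h0 : Good fun _ => 0 :=
    ⟨measurable_const.aemeasurable, fun _ => le_rfl, by simp [hΨ.map_zero], by simp [hΨ.map_zero]⟩
  let S : ℕ → {S // Good S} := fun m =>
    Nat.rec ⟨_, h0⟩ (fun _ S => ⟨fun ω => S.1 ω + ‖g (N S) ω‖, hN S⟩) m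
  refine ⟨fun m => N (S m), fun m => ?_⟩
  have hS : ∀ m ω, (S m).1 ω = ∑ k ∈ Finset.range m, ‖g (N (S k)) ω‖ := by
    intro m ω
    induction m with
    | zero => rfl
    | succ m ih => rw [Finset.sum_range_succ, ← ih]
  simp_rw [← hS]
  exact (S m).2.2.2.2

/-- A weakly unconditionally Cauchy sequence which is bounded below admits a lower `c₀`-estimate on
a subsequence. -/
lemma exists_lower_estimate {Y : Type*} [NormedAddCommGroup Y] [NormedSpace ℂ Y] (y : ℕ → Y)
    {ε M : ℝ} (hε : 0 < ε) (hy : ∀ n, ε ≤ ‖y n‖)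
    (hM : ∀ (co : ℕ → ℂ) (s : Finset ℕ), (∀ k, ‖co k‖ ≤ 1) → ‖∑ k ∈ s, co k • y k‖ ≤ M) :
    ∃ φ : ℕ → ℕ, Function.Injective φ ∧ ∀ (co : ℕ → ℂ) (s : Finset ℕ),
      ε / 2 * (⨆ k ∈ s, ‖co k‖) ≤ ‖∑ k ∈ s, co k • y (φ k)‖ := by
  have hdual : ∀ n, ∃ f : StrongDual ℂ Y, ‖f‖ ≤ 1 ∧ f (y n) = ‖y n‖ := fun n => by
    obtain ⟨f, hf, hfy⟩ := exists_dual_vector'' ℂ (y n)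
    exact ⟨f, hf, by simpa using hfy⟩
  choose f hf hfy using hdual
  have hrow : ∀ j s, ∑ k ∈ s, ‖f j (y k)‖ ≤ M := by
    intro j s
    set co : ℕ → ℂ := fun k => star (f j (y k)) / ‖f j (y k)‖ with hco
    have hco1 : ∀ k, ‖co k‖ ≤ 1 := fun k => by
      simp only [hco, norm_div, norm_star, Complex.norm_real, norm_norm]
      exact div_self_le_one _
    have hcof : ∀ k, co k * f j (y k) = (‖f j (y k)‖ : ℝ) := by
      intro k
      by_cases hz : f j (y k) = 0
      · simp [hz]
      have hz' : (‖f j (y k)‖ : ℂ) ≠ 0 := by exact_mod_cast norm_ne_zero_iff.2 hz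
      simp only [hco]
      rw [div_mul_eq_mul_div, div_eq_iff hz', Complex.star_def, Complex.conj_mul']
      ring
    have h1 : f j (∑ k ∈ s, co k • y k) = ((∑ k ∈ s, ‖f j (y k)‖ : ℝ) : ℂ) := by
      rw [map_sum]
      push_cast
      exact Finset.sum_congr rfl fun k _ => by rw [map_smul, smul_eq_mul, hcof]
    have h2 := (f j).le_of_opNorm_le (hf j) (∑ k ∈ s, co k • y k)
    rw [h1, Complex.norm_real, Real.norm_of_nonneg (by positivity), one_mul] at h2
    exact h2.trans (hM co s hco1)
  obtain ⟨m, hm⟩ := exists_nat_ge (M / (ε / 2))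
  obtain ⟨φ, hφ, hsum⟩ := exists_injective_sum_le (ε / 2) m (fun j k => ‖f j (y k)‖)
    (fun _ _ => norm_nonneg _) (fun j s _ => (hrow j s).trans (by
      rw [div_le_iff₀ (by positivity)] at hm
      linarith))
  refine ⟨φ, hφ, fun co s => ?_⟩
  rcases s.eq_empty_or_nonempty with rfl | hs
  · simp
  obtain ⟨j, hj, hmax⟩ := s.exists_max_image (fun k => ‖co k‖) hs
  have hsup : (⨆ k ∈ s, ‖co k‖) ≤ ‖co j‖ := biSup_norm_le co s (norm_nonneg _) hmax
  have h1 : f (φ j) (∑ k ∈ s, co k • y (φ k)) =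
      co j * ‖y (φ j)‖ + ∑ k ∈ s.erase j, co k * f (φ j) (y (φ k)) := by
    rw [map_sum, ← Finset.add_sum_erase s _ hj]
    simp [hfy]
  have h2 : ‖∑ k ∈ s.erase j, co k * f (φ j) (y (φ k))‖ ≤ ‖co j‖ * (ε / 2) := by
    calc _ ≤ ∑ k ∈ s.erase j, ‖co j‖ * ‖f (φ j) (y (φ k))‖ := by
          refine (norm_sum_le _ _).trans (Finset.sum_le_sum fun k hk => ?_)
          rw [norm_mul]
          gcongr
          exact hmax k (Finset.mem_of_mem_erase hk)
      _ ≤ _ := by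
          rw [← Finset.mul_sum]
          gcongr
          exact hsum j _ (Finset.notMem_erase j s)
  have h3 := (f (φ j)).le_of_opNorm_le (hf _) (∑ k ∈ s, co k • y (φ k))
  rw [h1, one_mul] at h3
  have h4 := norm_sub_le (co j * ‖y (φ j)‖ + ∑ k ∈ s.erase j, co k * f (φ j) (y (φ k)))
    (∑ k ∈ s.erase j, co k * f (φ j) (y (φ k)))
  rw [add_sub_cancel_right, norm_mul, Complex.norm_real, norm_norm] at h4
  have h5 : ‖co j‖ * ε ≤ ‖co j‖ * ‖y (φ j)‖ := by gcongr; exact hy _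
  have h6 : ε / 2 * (⨆ k ∈ s, ‖co k‖) ≤ ε / 2 * ‖co j‖ := by gcongr
  linarith

lemma luxNorm_le_mul (hΨ : IsOrliczFunction Ψ) {f : Ω → ℂ} {S : Ω → ℝ} {c K : ℝ} (hc : 0 < c)
    (hK : 0 ≤ K) (hfS : ∀ ω, ‖f ω‖ ≤ K * S ω) (hS0 : ∀ ω, 0 ≤ S ω)
    (hS : ∫⁻ ω, ENNReal.ofReal (Ψ (c * S ω)) ∂μ ≤ 1) : luxNorm Ψ μ f ≤ c⁻¹ * K := by
  have key : ∀ K', K < K' → luxNorm Ψ μ f ≤ c⁻¹ * K' := by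
    intro K' hK'
    have hK'0 : 0 < K' := hK.trans_lt hK'
    refine luxNorm_le (by positivity) (le_trans (lintegral_mono fun ω => ?_) hS)
    refine ENNReal.ofReal_le_ofReal (hΨ.mono' (by positivity) ?_)
    rw [div_le_iff₀ (by positivity)]
    have e : c * S ω * (c⁻¹ * K') = K' * S ω := by field_simp
    rw [e]
    exact (hfS ω).trans (mul_le_mul_of_nonneg_right hK'.le (hS0 ω))
  have hlim : Tendsto (fun K' => c⁻¹ * K') (𝓝[>] K) (𝓝 (c⁻¹ * K)) :=
    ((continuous_const.mul continuous_id).tendsto K).mono_left nhdsWithin_le_nhds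
  exact ge_of_tendsto hlim (eventually_nhdsWithin_of_forall key)

/-- If the estimate fails for `ε`, there is a modularly summable sequence on which `T` is bounded
below. -/
lemma exists_seq_of_not_estimate (X : Submodule ℂ (Ω → ℂ))
    (hXM : ∀ f ∈ X, MemMorseTransue Ψ μ f)
    {Y : Type*} [NormedAddCommGroup Y] [NormedSpace ℂ Y] (T : X →ₗ[ℂ] Y) {M : ℝ} (hM0 : 0 < M)
    (hM : ∀ f : X, ‖T f‖ ≤ M * luxNorm Ψ μ (f : Ω → ℂ)) {ε : ℝ} (hε : 0 < ε)
    (h : ∀ C > 0, ∃ f : X, luxNorm Ψ μ (f : Ω → ℂ) ≠ 0 ∧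
      (C * (orliczModular Ψ μ (f : Ω → ℂ)
        (luxNorm Ψ μ (f : Ω → ℂ) / ε)).toReal + ε) * luxNorm Ψ μ (f : Ω → ℂ) < ‖T f‖) :
    ∃ g : ℕ → X, (∀ n, ε ≤ ‖T (g n)‖) ∧
      ∑' n, ∫⁻ ω, ENNReal.ofReal (Ψ (ε * ‖(g n : Ω → ℂ) ω‖)) ∂μ ≠ ⊤ := by
  have hn : ∀ n : ℕ, ∃ g : X, ε ≤ ‖T g‖ ∧
      ∫⁻ ω, ENNReal.ofReal (Ψ (ε * ‖(g : Ω → ℂ) ω‖)) ∂μ ≤ ENNReal.ofReal ((1 / 2) ^ n) := by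
    intro n
    obtain ⟨f, hf0, hf⟩ := h (M * 2 ^ n) (by positivity)
    set L := luxNorm Ψ μ (f : Ω → ℂ) with hL
    have hL0 : 0 < L := lt_of_le_of_ne (luxNorm_nonneg _) (Ne.symm hf0)
    set m := orliczModular Ψ μ (f : Ω → ℂ) (L / ε) with hm
    have hmfin : m ≠ ⊤ := ((hXM _ f.2).2 _ (by positivity)).ne
    refine ⟨(L : ℂ)⁻¹ • f, ?_, ?_⟩
    · rw [map_smul, norm_smul, norm_inv, Complex.norm_real, Real.norm_of_nonneg hL0.le,
        le_inv_mul_iff₀ hL0]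
      have : 0 ≤ M * 2 ^ n * m.toReal * L := by positivity
      linarith
    · have e : ∫⁻ ω, ENNReal.ofReal (Ψ (ε * ‖(((L : ℂ)⁻¹ • f : X) : Ω → ℂ) ω‖)) ∂μ = m := by
        refine lintegral_congr fun ω => ?_
        congr 2
        simp only [Submodule.coe_smul, Pi.smul_apply, norm_smul, norm_inv, Complex.norm_real,
          Real.norm_of_nonneg hL0.le]
        field_simp
      rw [e, ← ENNReal.ofReal_toReal hmfin]
      refine ENNReal.ofReal_le_ofReal ?_
      have h1 := lt_of_mul_lt_mul_right (hf.trans_le (hM f)) hL0.le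
      have h2 : M * (2 ^ n * m.toReal) < M * 1 := by linarith
      have h3 := lt_of_mul_lt_mul_left h2 hM0.le
      rw [one_div, inv_pow, ← one_div, le_div_iff₀ (by positivity)]
      linarith
  choose g hg1 hg2 using hn
  refine ⟨g, hg1, ne_top_of_le_ne_top ?_ (ENNReal.tsum_le_tsum hg2)⟩
  rw [← ENNReal.ofReal_tsum_of_nonneg (fun m => by positivity) summable_geometric_two]
  exact ENNReal.ofReal_ne_top

lemma fixesCopyOfC0_of_not_estimate (hΨ : IsOrliczFunction Ψ)
    (X : Submodule ℂ (Ω → ℂ)) (hXM : ∀ f ∈ X, MemMorseTransue Ψ μ f)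
    {Y : Type*} [NormedAddCommGroup Y] [NormedSpace ℂ Y] (T : X →ₗ[ℂ] Y) {M : ℝ} (hM0 : 0 < M)
    (hM : ∀ f : X, ‖T f‖ ≤ M * luxNorm Ψ μ (f : Ω → ℂ)) {ε : ℝ} (hε : 0 < ε)
    (h : ∀ C > 0, ∃ f : X, luxNorm Ψ μ (f : Ω → ℂ) ≠ 0 ∧
      (C * (orliczModular Ψ μ (f : Ω → ℂ)
        (luxNorm Ψ μ (f : Ω → ℂ) / ε)).toReal + ε) * luxNorm Ψ μ (f : Ω → ℂ) < ‖T f‖) :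
    FixesCopyOfC0 Ψ μ T := by
  obtain ⟨g, hgT, hgsum⟩ := exists_seq_of_not_estimate X hXM T hM0 hM hε h
  have hc : 0 < ε / 2 := by positivity
  obtain ⟨n, hn⟩ := exists_seq_lintegral_sum_lt_one (μ := μ) (g := fun n => (g n : Ω → ℂ)) hΨ hc
    (fun n => hXM _ (g n).2) (by rwa [mul_div_cancel₀ _ (two_ne_zero' ℝ)])
  set w : ℕ → X := fun k => g (n k) with hw
  have hupper : ∀ (co : ℕ → ℂ) (s : Finset ℕ) (K : ℝ), 0 ≤ K → (∀ k ∈ s, ‖co k‖ ≤ K) →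
      luxNorm Ψ μ ((∑ k ∈ s, co k • w k : X) : Ω → ℂ) ≤ (ε / 2)⁻¹ * K := by
    intro co s K hK hco
    obtain ⟨m, hm⟩ := s.exists_nat_subset_range
    refine luxNorm_le_mul hΨ (S := fun ω => ∑ k ∈ Finset.range m, ‖(w k : Ω → ℂ) ω‖) hc hK
      (fun ω => ?_) (fun ω => by positivity) (hn m).le
    rw [coe_sum_smul_apply]
    calc ‖∑ k ∈ s, co k * (w k : Ω → ℂ) ω‖ ≤ ∑ k ∈ s, K * ‖(w k : Ω → ℂ) ω‖ := by
          refine (norm_sum_le _ _).trans (Finset.sum_le_sum fun k hk => ?_)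
          rw [norm_mul]
          gcongr
          exact hco k hk
      _ ≤ _ := by
          rw [← Finset.mul_sum]
          gcongr
  obtain ⟨φ, hφ, hlow⟩ := exists_lower_estimate (fun k => T (w k)) (M := M * ((ε / 2)⁻¹ * 1)) hε
    (fun k => hgT _) (fun co s hco => by
      have h1 := hM (∑ k ∈ s, co k • w k)
      simp only [map_sum, map_smul] at h1
      refine h1.trans ?_
      gcongr
      exact hupper co s 1 zero_le_one fun k _ => hco k)
  refine ⟨fun k => w (φ k), M⁻¹ * (ε / 2), (ε / 2)⁻¹, ε / 2, by positivity, by positivity, hc,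
    fun co s => ?_⟩
  have h3 : ε / 2 * (⨆ k ∈ s, ‖co k‖) ≤ ‖T (∑ k ∈ s, co k • w (φ k))‖ := by
    simpa only [map_sum, map_smul] using hlow co s
  refine ⟨?_, ?_, h3⟩
  · rw [mul_assoc, inv_mul_le_iff₀ hM0]
    exact h3.trans (hM _)
  · have e : ∑ k ∈ s, co k • w (φ k) =
        ∑ k ∈ s.map ⟨φ, hφ⟩, co (Function.invFun φ k) • w k := by
      rw [Finset.sum_map]
      refine Finset.sum_congr rfl fun k _ => ?_
      simp [Function.leftInverse_invFun hφ k]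
    rw [e]
    refine hupper _ _ _ (biSup_norm_nonneg co s) fun k hk => ?_
    obtain ⟨i, hi, rfl⟩ := Finset.mem_map.1 hk
    simpa [Function.leftInverse_invFun hφ i] using le_biSup_norm co s hi

end Operators

noncomputable section

/-- An operator `T` on a subspace `X` of the Morse–Transue space `M^Ψ` fixes no copy of `c₀`
if and only if for every `ε > 0` there is `C_ε > 0` such that
`‖Tf‖ ≤ (C_ε ∫ Ψ(ε|f|/‖f‖_Ψ) dP + ε) ‖f‖_Ψ` for every nonzero `f ∈ X`. -/
theorem statement0 {Ω : Type*} [MeasurableSpace Ω] (μ : Measure Ω) [IsProbabilityMeasure μ]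
    {Ψ : ℝ → ℝ} (hΨ : IsOrliczFunction Ψ)
    (X : Submodule ℂ (Ω → ℂ)) (hXM : ∀ f ∈ X, MemMorseTransue Ψ μ f)
    (hXclosed : IsLuxClosedIn Ψ μ X)
    {Y : Type*} [NormedAddCommGroup Y] [NormedSpace ℂ Y] [CompleteSpace Y]
    (T : X →ₗ[ℂ] Y) (hT : ∃ M : ℝ, ∀ f : X, ‖T f‖ ≤ M * luxNorm Ψ μ (f : Ω → ℂ)) :
    ¬ FixesCopyOfC0 Ψ μ T ↔
      ∀ ε > 0, ∃ C > 0, ∀ f : X, luxNorm Ψ μ (f : Ω → ℂ) ≠ 0 →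
        ‖T f‖ ≤ (C * (orliczModular Ψ μ (f : Ω → ℂ)
              (luxNorm Ψ μ (f : Ω → ℂ) / ε)).toReal + ε) * luxNorm Ψ μ (f : Ω → ℂ) := by
  obtain ⟨M, hM⟩ := hT
  have hM' : ∀ f : X, ‖T f‖ ≤ max M 1 * luxNorm Ψ μ (f : Ω → ℂ) := fun f =>
    (hM f).trans (mul_le_mul_of_nonneg_right (le_max_left _ _) (luxNorm_nonneg _))
  refine ⟨fun hfix ε hε => ?_, not_fixesCopyOfC0_of_estimate hΨ X hXM T⟩
  by_contra! hcon
  exact hfix (fixesCopyOfC0_of_not_estimate hΨ X hXM T (by positivity) hM' hε hcon)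

end
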